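/- Let d and m be integers with 3 ≤ m < d/2, and let n be an integer with Σ_{j=0}^{m−1} 2^j·binom(d,j) < n ≤ Σ_{j=0}^m 2^j·binom(d,j). Then log n/(2·log(4ed/log n)) ≤ m ≤ log n/log(2d/log n) + 1, where log denotes the base-2 logarithm and e is Euler's number. -/

import Mathlib

theorem Nat.pow_le_pow_mul_choose {d k : ℕ} (h : k ≤ d) : d ^ k ≤ k ^ k * d.choose k := by
  have key : d ^ k * k.descFactorial k ≤ k ^ k * d.descFactorial k := by
    rw [Nat.descFactorial_eq_prod_range, Nat.descFactorial_eq_prod_range,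
      ← Finset.card_range k, ← Finset.prod_const, ← Finset.prod_const, Finset.card_range,
      ← Finset.prod_mul_distrib, ← Finset.prod_mul_distrib]
    refine Finset.prod_le_prod' fun i _ => ?_
    rw [Nat.mul_sub, Nat.mul_sub, Nat.mul_comm d k]
    exact Nat.sub_le_sub_left (Nat.mul_le_mul_right i h) _
  rw [Nat.descFactorial_self, Nat.descFactorial_eq_factorial_mul_choose] at key
  refine _root_.le_of_mul_le_mul_right ?_ k.factorial_pos
  calc d ^ k * k.factorial ≤ k ^ k * (k.factorial * d.choose k) := key
    _ = k ^ k * d.choose k * k.factorial := by ring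

theorem sum_two_pow_mul_choose_le_three_pow {d m : ℕ} (h : m ≤ d) :
    ∑ j ∈ Finset.range (m + 1), 2 ^ j * d.choose j ≤ 3 ^ d := by
  have key : ∑ j ∈ Finset.range (d + 1), 2 ^ j * d.choose j = 3 ^ d := by
    simpa using (add_pow (2 : ℕ) 1 d).symm
  rw [← key]
  exact Finset.sum_le_sum_of_subset (Finset.range_mono (by lia))

theorem sum_two_pow_mul_choose_le {d m : ℕ} (hm : 0 < m) (h : m ≤ d) :
    (∑ j ∈ Finset.range (m + 1), 2 ^ j * (d.choose j : ℝ)) ≤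
      (2 * Real.exp 1 * d / m) ^ m := by
  have hm' : (0 : ℝ) < m := by exact_mod_cast hm
  have hd' : (0 : ℝ) < d := by exact_mod_cast hm.trans_le h
  have ht1 : (m / d : ℝ) ≤ 1 := (div_le_one hd').2 (by exact_mod_cast h)
  have hexp : (m / d + 1 : ℝ) ^ d ≤ Real.exp 1 ^ m := by
    calc (m / d + 1 : ℝ) ^ d ≤ Real.exp (m / d) ^ d := by
          gcongr
          exact Real.add_one_le_exp _
      _ = Real.exp 1 ^ m := by
          rw [← Real.exp_nat_mul, ← Real.exp_nat_mul]
          congr 1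
          field_simp
  have hbinom : ∑ j ∈ Finset.range (m + 1), (m / d : ℝ) ^ j * d.choose j ≤ (m / d + 1) ^ d := by
    rw [add_pow]
    simp only [one_pow, mul_one]
    exact Finset.sum_le_sum_of_subset_of_nonneg (Finset.range_mono (by lia))
      fun _ _ _ => by positivity
  have hsum : (∑ j ∈ Finset.range (m + 1), 2 ^ j * (d.choose j : ℝ)) * (m / d : ℝ) ^ m ≤
      2 ^ m * ∑ j ∈ Finset.range (m + 1), (m / d : ℝ) ^ j * d.choose j := by
    rw [Finset.sum_mul, Finset.mul_sum]
    refine Finset.sum_le_sum fun j hj => ?_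
    have hj' : j ≤ m := by simpa [Nat.lt_succ_iff] using hj
    have h1 : (2 : ℝ) ^ j ≤ 2 ^ m := pow_le_pow_right₀ one_le_two hj'
    have h2 : (m / d : ℝ) ^ m ≤ (m / d : ℝ) ^ j := pow_le_pow_of_le_one (by positivity) ht1 hj'
    calc 2 ^ j * (d.choose j : ℝ) * (m / d : ℝ) ^ m
        ≤ 2 ^ m * (d.choose j : ℝ) * (m / d : ℝ) ^ j := by gcongr
      _ = 2 ^ m * ((m / d : ℝ) ^ j * d.choose j) := by ring
  refine le_of_mul_le_mul_right ?_ (show (0 : ℝ) < (m / d : ℝ) ^ m by positivity)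
  calc _ ≤ 2 ^ m * ∑ j ∈ Finset.range (m + 1), (m / d : ℝ) ^ j * d.choose j := hsum
    _ ≤ 2 ^ m * Real.exp 1 ^ m := by gcongr; exact hbinom.trans hexp
    _ = (2 * Real.exp 1 * d / m) ^ m * (m / d : ℝ) ^ m := by
        rw [← mul_pow, ← mul_pow]
        congr 1
        field_simp

theorem Real.logb_two_le_self {t : ℝ} (ht : 0 < t) : Real.logb 2 t ≤ t := by
  rw [Real.logb_le_iff_le_rpow one_lt_two ht]
  rcases le_total 1 t with h | h
  · have := one_add_mul_self_le_rpow_one_add (s := 1) (by norm_num) h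
    norm_num at this
    linarith
  · exact h.trans (Real.one_le_rpow one_le_two ht.le)

/-- If `x ≤ log₂ y`, then `x ≤ 2 log₂ (2y / x)`. -/
theorem le_two_mul_logb_of_le_logb {x y : ℝ} (hx : 0 < x) (hy : 0 < y)
    (h : x ≤ Real.logb 2 y) : x ≤ 2 * Real.logb 2 (2 * y / x) := by
  have h1 := Real.logb_two_le_self (half_pos hx)
  have h2 : 2 * y / x = y / (x / 2) := by field_simp
  rw [h2, Real.logb_div hy.ne' (half_pos hx).ne']
  linarith

/-- for integers `3 ≤ m < d/2` and `n` with
`Σ_{j=0}^{m−1} 2^j·C(d,j) < n ≤ Σ_{j=0}^m 2^j·C(d,j)`,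
`log n/(2·log(4ed/log n)) ≤ m ≤ log n/log(2d/log n) + 1` (base-2 logs). -/
theorem stmt_13 (d m : ℕ) (hm : 3 ≤ m) (hmd : 2 * m < d) (n : ℕ)
    (hn1 : ∑ j ∈ Finset.range m, 2 ^ j * Nat.choose d j < n)
    (hn2 : n ≤ ∑ j ∈ Finset.range (m + 1), 2 ^ j * Nat.choose d j) :
    Real.logb 2 n / (2 * Real.logb 2 (4 * Real.exp 1 * d / Real.logb 2 n)) ≤ (m : ℝ) ∧
    (m : ℝ) ≤ Real.logb 2 n / Real.logb 2 (2 * d / Real.logb 2 n) + 1 := by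
  obtain ⟨k, rfl⟩ : ∃ k, m = k + 1 := ⟨m - 1, by lia⟩
  have hk : (0 : ℝ) < k := by exact_mod_cast (show 0 < k by lia)
  have hd : (0 : ℝ) < d := by exact_mod_cast (show 0 < d by lia)
  have hkd : 2 * (k : ℝ) ≤ 2 * d := by exact_mod_cast (show 2 * k ≤ 2 * d by lia)
  have hn : (0 : ℝ) < n := by exact_mod_cast (Nat.zero_le _).trans_lt hn1
  have hlow : (k : ℝ) * Real.logb 2 (2 * d / k) ≤ Real.logb 2 n := by
    rw [← Real.logb_pow]
    refine Real.logb_le_logb_of_le one_lt_two (by positivity) ?_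
    have h1 : 2 ^ k * d.choose k ≤ n :=
      (Finset.single_le_sum (f := fun j => 2 ^ j * d.choose j) (fun _ _ => Nat.zero_le _)
        (Finset.self_mem_range_succ k)).trans hn1.le
    have h2 : (d : ℝ) ^ k ≤ k ^ k * d.choose k := by
      exact_mod_cast Nat.pow_le_pow_mul_choose (show k ≤ d by lia)
    have h1' : (2 : ℝ) ^ k * d.choose k ≤ n := by exact_mod_cast h1
    rw [div_pow, mul_pow, div_le_iff₀ (by positivity)]
    calc (2 : ℝ) ^ k * d ^ k ≤ 2 ^ k * (k ^ k * d.choose k) := by gcongr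
      _ = 2 ^ k * d.choose k * k ^ k := by ring
      _ ≤ n * k ^ k := by gcongr
  have hkL : (k : ℝ) ≤ Real.logb 2 n := by
    have h1 : (1 : ℝ) ≤ Real.logb 2 (2 * d / k) := by
      rw [Real.le_logb_iff_rpow_le one_lt_two (by positivity), Real.rpow_one,
        le_div_iff₀ hk]
      exact hkd
    nlinarith
  have hL : 0 < Real.logb 2 n := hk.trans_le hkL
  have hLd : Real.logb 2 n < 2 * d := by
    rw [Real.logb_lt_iff_lt_rpow one_lt_two hn]
    have h1 : n < 4 ^ d :=
      (hn2.trans (sum_two_pow_mul_choose_le_three_pow (by lia))).trans_lt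
        (Nat.pow_lt_pow_left (by norm_num) (by lia))
    rw [Real.rpow_mul zero_le_two, Real.rpow_natCast]
    norm_num
    exact_mod_cast h1
  have hup : Real.logb 2 n ≤
      ((k + 1 : ℕ) : ℝ) * Real.logb 2 (2 * Real.exp 1 * d / (k + 1 : ℕ)) := by
    rw [← Real.logb_pow]
    refine Real.logb_le_logb_of_le one_lt_two hn ?_
    refine le_trans ?_ (sum_two_pow_mul_choose_le (Nat.succ_pos k) (show k + 1 ≤ d by lia))
    exact_mod_cast hn2
  constructor
  · have hm' : (0 : ℝ) < (k + 1 : ℕ) := by positivity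
    have hpos : 0 < Real.logb 2 (4 * Real.exp 1 * d / Real.logb 2 n) := by
      refine Real.logb_pos one_lt_two ?_
      rw [one_lt_div hL]
      nlinarith [Real.add_one_le_exp (1 : ℝ)]
    have key := le_two_mul_logb_of_le_logb (div_pos hL hm')
      (show 0 < 2 * Real.exp 1 * d / (k + 1 : ℕ) by positivity)
      ((div_le_iff₀' hm').2 hup)
    have heq : 2 * (2 * Real.exp 1 * d / (k + 1 : ℕ)) / (Real.logb 2 n / (k + 1 : ℕ)) =
        4 * Real.exp 1 * d / Real.logb 2 n := by
      field_simp
      ring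
    rw [heq, div_le_iff₀' hm'] at key
    rwa [div_le_iff₀ (by positivity)]
  · have hpos : 0 < Real.logb 2 (2 * d / Real.logb 2 n) :=
      Real.logb_pos one_lt_two ((one_lt_div hL).2 hLd)
    have hmono : Real.logb 2 (2 * d / Real.logb 2 n) ≤ Real.logb 2 (2 * d / k) :=
      Real.logb_le_logb_of_le one_lt_two (by positivity) (by gcongr)
    rw [Nat.cast_succ, add_le_add_iff_right, le_div_iff₀ hpos]
    exact (mul_le_mul_of_nonneg_left hmono hk.le).trans hlow
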